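/- arXiv:1811.07165 — 9 statements merged into one kernel-verified Lean document; each statement's English description precedes it below -/
import Mathlib

section
/- Let φ : R → J be a unitary homomorphism of rings that is a weak epimorphism. Then J, regarded as a left R-module via φ, is self-small: for every set I, every R-linear map J → ⊕_{i∈I} J has image contained in the subsum indexed by a finite subset of I (equivalently, the canonical map ⊕_{i∈I} Hom_R(J, J) → Hom_R(J, ⊕_{i∈I} J) is bijective). -/
/-- **Proposition 1 (qepiss).** If `φ : R → J` is a weak epimorphism of rings (i.e. every
`R`-linear endomorphism of `J`, with `J` regarded as a left `R`-module via `φ`, is left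
`J`-linear), then `J` is self-small as an `R`-module: every `R`-linear map from `J` to a
direct sum of copies of `J` (realized as finitely supported functions `ι →₀ J`) has image
contained in the subsum indexed by some finite subset of `ι`. -/
theorem weak_epimorphism_self_small {R J : Type*} [Ring R] [Ring J] (φ : R →+* J)
    (hweak : ∀ f : J →+ J, (∀ (r : R) (x : J), f (φ r * x) = φ r * f x) →
      ∀ (a x : J), f (a * x) = a * f x)
    (ι : Type*) (f : J →+ (ι →₀ J))
    (hf : ∀ (r : R) (x : J) (i : ι), f (φ r * x) i = φ r * f x i) :
    ∃ s : Finset ι, ∀ (x : J) (i : ι), i ∉ s → f x i = 0 := by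
  refine ⟨(f 1).support, fun x i hi => ?_⟩
  have h := hweak ((Finsupp.applyAddHom i).comp f) (fun r x => hf r x i) x 1
  simpa [Finsupp.notMem_support_iff.mp hi] using h
end

section
/- Let φ : R → J be a unitary ring homomorphism that is an epimorphism in the category of rings (i.e., for all ring homomorphisms ψ, ζ : J → J', ψ ∘ φ = ζ ∘ φ implies ψ = ζ). Then J, regarded as a left R-module via φ, is self-small. -/
universe u v w

/-- The ring homomorphism `a ↦ a + ε (c a - a c)` into the square-zero extension of a ring by
itself, that is, conjugation by `1 + ε c`. -/
def innerDeformation {A : Type*} [Ring A] (c : A) : A →+* TrivSqZeroExt A A where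
  toFun a := (a, c * a - a * c)
  map_one' := TrivSqZeroExt.ext rfl (by change c * 1 - 1 * c = 0; simp)
  map_zero' := TrivSqZeroExt.ext rfl (by change c * 0 - 0 * c = 0; simp)
  map_add' a b := by
    refine TrivSqZeroExt.ext rfl ?_
    change c * (a + b) - (a + b) * c = (c * a - a * c) + (c * b - b * c)
    noncomm_ring
  map_mul' a b := by
    refine TrivSqZeroExt.ext rfl ?_
    change c * (a * b) - a * b * c = a * (c * b - b * c) + (c * a - a * c) * b
    noncomm_ring

/-- An element commuting with the image of a ring epimorphism `φ : R →+* J` under a ring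
homomorphism `ρ : J →+* A` commutes with the whole image of `ρ`. -/
theorem commute_of_ring_epimorphism {R : Type u} {J A : Type v} [Ring R] [Ring J] [Ring A]
    (φ : R →+* J)
    (hepi : ∀ (J' : Type (max u v)) [Ring J'] (ψ ζ : J →+* J'),
      ψ.comp φ = ζ.comp φ → ψ = ζ)
    (ρ : J →+* A) (c : A) (hc : ∀ r, Commute c (ρ (φ r))) (x : J) : Commute c (ρ x) := by
  let up : TrivSqZeroExt A A →+* ULift.{u} (TrivSqZeroExt A A) :=
    (ULift.ringEquiv (R := TrivSqZeroExt A A)).symm.toRingHom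
  have h := hepi (ULift.{u} (TrivSqZeroExt A A)) (up.comp ((innerDeformation c).comp ρ))
    (up.comp ((TrivSqZeroExt.inlHom A A).comp ρ)) (by
      ext r : 1
      refine congrArg up (TrivSqZeroExt.ext rfl ?_)
      exact sub_eq_zero.2 (hc r))
  have hx := congrArg (fun y => y.down.snd) (RingHom.congr_fun h x)
  exact sub_eq_zero.1 hx

/-- **Corollary (episs).** If `φ : R → J` is an epimorphism in the category of rings,
then `J`, regarded as a left `R`-module via `φ`, is self-small: every `R`-linear map from
`J` to a direct sum of copies of `J` (realized as finitely supported functions `ι →₀ J`)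
has image contained in the subsum indexed by some finite subset of `ι`. -/
theorem ring_epimorphism_self_small {R : Type u} {J : Type v} [Ring R] [Ring J] (φ : R →+* J)
    (hepi : ∀ (J' : Type (max u v)) [Ring J'] (ψ ζ : J →+* J'),
      ψ.comp φ = ζ.comp φ → ψ = ζ)
    (ι : Type w) (f : J →+ (ι →₀ J))
    (hf : ∀ (r : R) (x : J) (i : ι), f (φ r * x) i = φ r * f x i) :
    ∃ s : Finset ι, ∀ (x : J) (i : ι), i ∉ s → f x i = 0 := by
  refine ⟨(f 1).support, fun x i hi => ?_⟩
  let g : AddMonoid.End J := (Finsupp.applyAddHom i).comp f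
  have hg := commute_of_ring_epimorphism φ hepi (Module.toAddMonoidEnd J J) g
    (fun r => AddMonoidHom.ext fun y => hf r y i) x
  have h1 : f (x * 1) i = x * f 1 i := DFunLike.congr_fun hg (1 : J)
  rw [← mul_one x, h1, Finsupp.notMem_support_iff.1 hi, mul_zero]
end

section
/- The abelian group ℚ is self-small: for every set I, every additive group homomorphism ℚ → ⊕_{i∈I} ℚ has image contained in the subsum indexed by a finite subset of I. -/
/-- **Example.** The abelian group `ℚ` is self-small: for every set `ι`, every additive
group homomorphism from `ℚ` to the direct sum `⊕_{i ∈ ι} ℚ` (realized as finitely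
supported functions `ι →₀ ℚ`) has image contained in the subsum indexed by some finite
subset of `ι`. -/
theorem rat_self_small (ι : Type*) (f : ℚ →+ (ι →₀ ℚ)) :
    ∃ s : Finset ι, ∀ (x : ℚ) (i : ι), i ∉ s → f x i = 0 := by
  refine ⟨(f 1).support, fun x i hi => ?_⟩
  have hx : f x = x • f 1 := by
    simpa using map_rat_smul f x 1
  rw [hx, Finsupp.smul_apply, Finsupp.notMem_support_iff.mp hi, smul_zero]
end

section
/- Assume condition (1) and condition (3'): for all 1 ≤ m < n, every R-linear map Z_m → Z_n extends to an R-linear map Z_{m+1} → Z_n. Then condition (3) holds: for every m ≥ 1, every R-linear map Z_m → M extends to an R-linear map Z_{m+1} → M. -/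
/-- **Lemma (znforz).** Let `R` be a commutative ring and `M` an `R`-module which is the
union of an ascending chain of submodules `Z 0 ⊆ Z 1 ⊆ ⋯`. Assume condition (1): each
`Z n` is finitely presented; and condition (3'): for all `m < n`, every `R`-linear map
`Z m → Z n` extends along the inclusion to an `R`-linear map `Z (m+1) → Z n`. Then
condition (3) holds: every `R`-linear map `Z m → M` extends along the inclusion to an
`R`-linear map `Z (m+1) → M`. -/
theorem cond_one_and_three'_imp_three {R : Type*} [CommRing R]
    {M : Type*} [AddCommGroup M] [Module R M]
    (Z : ℕ → Submodule R M) (hmono : Monotone Z) (hsup : ∀ x : M, ∃ n, x ∈ Z n)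
    (h1 : ∀ n, Module.FinitePresentation R ↥(Z n))
    (h3' : ∀ (m n : ℕ), m < n → ∀ f : ↥(Z m) →ₗ[R] ↥(Z n),
      ∃ g : ↥(Z (m + 1)) →ₗ[R] ↥(Z n),
        ∀ x : ↥(Z m), g (Submodule.inclusion (hmono (Nat.le_succ m)) x) = f x) :
    ∀ (m : ℕ) (f : ↥(Z m) →ₗ[R] M), ∃ g : ↥(Z (m + 1)) →ₗ[R] M,
      ∀ x : ↥(Z m), g (Submodule.inclusion (hmono (Nat.le_succ m)) x) = f x := by
  intro m f
  have := h1 m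
  have hfg : (LinearMap.range f).FG := by
    rw [LinearMap.range_eq_map]
    exact Module.Finite.fg_top.map f
  obtain ⟨s, hs⟩ := hfg
  choose N hN using hsup
  let n := max (s.sup N) (m + 1)
  have hle : LinearMap.range f ≤ Z n := by
    rw [← hs, Submodule.span_le]
    intro x hx
    exact hmono ((Finset.le_sup (f := N) hx).trans (le_max_left _ _)) (hN x)
  have hmn : m < n := lt_of_lt_of_le m.lt_succ_self (le_max_right _ _)
  obtain ⟨g, hg⟩ := h3' m n hmn (f.codRestrict (Z n) fun x => hle ⟨x, rfl⟩)
  refine ⟨(Z n).subtype ∘ₗ g, fun x => ?_⟩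
  rw [LinearMap.comp_apply, hg]
  rfl
end

section
/- Assume conditions (1) and (2). Then for every m ≥ 1 there is an R-module isomorphism Hom_R(Z_m, M) ≅ Z_m; in particular, every R-linear map Z_m → M factors through the inclusion Z_n ⊆ M for some n ≥ m. -/
/-- A finitely generated submodule of the union of a chain is contained in some member. -/
theorem Submodule.FG.exists_le_of_monotone {R M : Type*} [Semiring R] [AddCommMonoid M]
    [Module R M] {Z : ℕ → Submodule R M} (hmono : Monotone Z) (hsup : ∀ x : M, ∃ n, x ∈ Z n)
    {N : Submodule R M} (hN : N.FG) (m : ℕ) : ∃ n, m ≤ n ∧ N ≤ Z n := by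
  obtain ⟨s, rfl⟩ := hN
  choose k hk using hsup
  refine ⟨max m (s.sup k), le_max_left _ _, Submodule.span_le.2 fun x hx ↦ ?_⟩
  exact hmono ((Finset.le_sup hx).trans (le_max_right _ _)) (hk x)

/-- **Lemma (homzz).** Let `R` be a commutative ring and `M` an `R`-module which is the
union of an ascending chain of submodules `Z 0 ⊆ Z 1 ⊆ ⋯`. Assume condition (1): each
`Z n` is finitely presented; and condition (2): for all `m ≤ n` there are `R`-module
isomorphisms `Hom_R(Z m, Z n) ≅ Z m` compatible with postcomposition with the inclusions.
Then for every `m` there is an `R`-module isomorphism `Hom_R(Z m, M) ≅ Z m`; in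
particular, every `R`-linear map `Z m → M` factors through the inclusion `Z n ⊆ M` for
some `n ≥ m`. -/
theorem hom_into_union_iso {R : Type*} [CommRing R]
    {M : Type*} [AddCommGroup M] [Module R M]
    (Z : ℕ → Submodule R M) (hmono : Monotone Z) (hsup : ∀ x : M, ∃ n, x ∈ Z n)
    (h1 : ∀ n, Module.FinitePresentation R ↥(Z n))
    (e : ∀ m n, m ≤ n → ((↥(Z m) →ₗ[R] ↥(Z n)) ≃ₗ[R] ↥(Z m)))
    (he : ∀ (m n n' : ℕ) (h : m ≤ n) (h' : n ≤ n') (f : ↥(Z m) →ₗ[R] ↥(Z n)),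
      e m n' (h.trans h') ((Submodule.inclusion (hmono h')).comp f) = e m n h f) :
    (∀ m : ℕ, Nonempty ((↥(Z m) →ₗ[R] M) ≃ₗ[R] ↥(Z m))) ∧
    (∀ (m : ℕ) (f : ↥(Z m) →ₗ[R] M), ∃ (n : ℕ) (_ : m ≤ n) (g : ↥(Z m) →ₗ[R] ↥(Z n)),
      ∀ x : ↥(Z m), f x = (g x : M)) := by
  have factor (m : ℕ) (f : Z m →ₗ[R] M) : ∃ g : Z m →ₗ[R] Z m, (Z m).subtype.comp g = f := by
    have := h1 m
    obtain ⟨n, hmn, hn⟩ := (Module.Finite.fg_top.map f).exists_le_of_monotone hmono hsup m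
    let f' : Z m →ₗ[R] Z n := f.codRestrict (Z n) fun x ↦ hn ⟨x, trivial, rfl⟩
    -- By compatibility, postcomposition with `Z m ⊆ Z n` is a bijection on homomorphisms.
    let g := (e m m le_rfl).symm (e m n hmn f')
    have hg : (Submodule.inclusion (hmono hmn)).comp g = f' :=
      (e m n hmn).injective ((he m m n le_rfl hmn g).trans (LinearEquiv.apply_symm_apply _ _))
    exact ⟨g, LinearMap.ext fun x ↦ congrArg Subtype.val (LinearMap.congr_fun hg x)⟩
  refine ⟨fun m ↦ ⟨?_⟩, fun m f ↦ ?_⟩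
  · refine (LinearEquiv.ofBijective (LinearMap.llcomp R (Z m) (Z m) M (Z m).subtype)
      ⟨fun g g' h ↦ ?_, factor m⟩).symm.trans (e m m le_rfl)
    exact LinearMap.ext fun x ↦ Subtype.ext (LinearMap.congr_fun h x)
  · obtain ⟨g, rfl⟩ := factor m f
    exact ⟨m, le_rfl, g, fun _ ↦ rfl⟩
end

section
/- Assume conditions (1) and (2), and let e_n : Hom_R(Z_n, M) ≅ Z_n be compatible R-module isomorphisms with δ_n : Z_{n+1} → Z_n defined as the composite e_n ∘ (restriction to Z_n) ∘ e_{n+1}^{-1}. Then the map End_R(M) → lim←(Z_n, δ_n) sending an endomorphism f to the sequence (e_n(f ∘ ι_n))_{n≥1}, where ι_n : Z_n ↪ M is the inclusion, is an isomorphism of R-modules End_R(M) ≅ lim←(Z_n, δ_n). -/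
/-- The inverse limit `lim← (Z n, δ n)` of an inverse system of submodules, realized as the
`R`-submodule of `∏ n, Z n` consisting of the sequences `x` with `δ n (x (n+1)) = x n`. -/
def invLimitSubmodule {R : Type*} [CommRing R] {M : Type*} [AddCommGroup M] [Module R M]
    (Z : ℕ → Submodule R M) (δ : ∀ n, ↥(Z (n + 1)) →ₗ[R] ↥(Z n)) :
    Submodule R (∀ n, ↥(Z n)) where
  carrier := { x | ∀ n, δ n (x (n + 1)) = x n }
  add_mem' {a b} ha hb := fun n => by simp [map_add, ha n, hb n]
  zero_mem' := fun n => by simp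
  smul_mem' c {a} ha := fun n => by simp [map_smul, ha n]

/-- Linear maps on the members of an exhaustive ascending chain of submodules that agree along
successive inclusions glue to a linear map on the whole module. -/
theorem exists_linearMap_comp_subtype_eq {R M N : Type*} [CommRing R] [AddCommGroup M] [Module R M]
    [AddCommGroup N] [Module R N] (Z : ℕ → Submodule R M) (hmono : Monotone Z)
    (hsup : ∀ x : M, ∃ n, x ∈ Z n) (g : ∀ n, ↥(Z n) →ₗ[R] N)
    (hg : ∀ n, g (n + 1) ∘ₗ Submodule.inclusion (hmono (Nat.le_succ n)) = g n) :
    ∃ f : M →ₗ[R] N, ∀ n, f ∘ₗ (Z n).subtype = g n := by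
  have hle : ∀ m n (h : m ≤ n) (x : M) (hx : x ∈ Z m), g n ⟨x, hmono h hx⟩ = g m ⟨x, hx⟩ := by
    intro m n h x hx
    induction n, h using Nat.le_induction with
    | base => rfl
    | succ n h ih => rw [← ih]; exact LinearMap.congr_fun (hg n) ⟨x, hmono h hx⟩
  have hgeq : ∀ m n (x : M) (hm : x ∈ Z m) (hn : x ∈ Z n), g m ⟨x, hm⟩ = g n ⟨x, hn⟩ := by
    intro m n x hm hn
    rcases le_total m n with h | h
    · exact (hle m n h x hm).symm
    · exact hle n m h x hn
  choose k hk using hsup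
  refine ⟨{ toFun := fun x => g (k x) ⟨x, hk x⟩, map_add' := ?_, map_smul' := ?_ }, ?_⟩
  · intro x y
    have hx : x ∈ Z (max (k x) (k y)) := hmono (le_max_left _ _) (hk x)
    have hy : y ∈ Z (max (k x) (k y)) := hmono (le_max_right _ _) (hk y)
    rw [hgeq _ _ x (hk x) hx, hgeq _ _ y (hk y) hy,
      hgeq _ _ (x + y) (hk _) (add_mem hx hy), ← map_add]
    rfl
  · intro c x
    rw [hgeq _ _ (c • x) (hk _) ((Z (k x)).smul_mem c (hk x)), RingHom.id_apply, ← map_smul]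
    rfl
  · intro n
    ext x
    exact hgeq _ _ _ _ x.2

/-- **Lemma (jislim).** Let `R` be a commutative ring and `M` an `R`-module which is the
union of an ascending chain of submodules `Z 0 ⊆ Z 1 ⊆ ⋯`. Assume condition (1): each
`Z n` is finitely presented; and condition (2): compatible isomorphisms
`Hom_R(Z m, Z n) ≅ Z m`.  Let `E n : Hom_R(Z n, M) ≅ Z n` be compatible `R`-module
isomorphisms and let `δ n : Z (n+1) → Z n` be the composite
`E n ∘ (restriction along the inclusion) ∘ (E (n+1))⁻¹`.  Then the map
`End_R(M) → lim← (Z n, δ n)` sending `f` to the sequence `(E n (f ∘ ι n))ₙ`, where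
`ι n : Z n ↪ M` is the inclusion, is an isomorphism of `R`-modules. -/
theorem end_iso_invLimit {R : Type*} [CommRing R]
    {M : Type*} [AddCommGroup M] [Module R M]
    (Z : ℕ → Submodule R M) (hmono : Monotone Z) (hsup : ∀ x : M, ∃ n, x ∈ Z n)
    (h1 : ∀ n, Module.FinitePresentation R ↥(Z n))
    (e : ∀ m n, m ≤ n → ((↥(Z m) →ₗ[R] ↥(Z n)) ≃ₗ[R] ↥(Z m)))
    (he : ∀ (m n n' : ℕ) (h : m ≤ n) (h' : n ≤ n') (f : ↥(Z m) →ₗ[R] ↥(Z n)),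
      e m n' (h.trans h') ((Submodule.inclusion (hmono h')).comp f) = e m n h f)
    (E : ∀ n, ((↥(Z n) →ₗ[R] M) ≃ₗ[R] ↥(Z n)))
    (δ : ∀ n, ↥(Z (n + 1)) →ₗ[R] ↥(Z n))
    (hδ : ∀ n, δ n = (E n).toLinearMap ∘ₗ
      (LinearMap.lcomp R M (Submodule.inclusion (hmono (Nat.le_succ n)))) ∘ₗ
        (E (n + 1)).symm.toLinearMap) :
    ∃ Φ : Module.End R M ≃ₗ[R] ↥(invLimitSubmodule Z δ),
      ∀ (f : Module.End R M) (n : ℕ),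
        (↑(Φ f) : ∀ k, ↥(Z k)) n = E n (f ∘ₗ (Z n).subtype) := by
  have hδE : ∀ n (h : ↥(Z (n + 1)) →ₗ[R] M),
      δ n (E (n + 1) h) = E n (h ∘ₗ Submodule.inclusion (hmono (Nat.le_succ n))) := by
    intro n h
    rw [hδ n]
    simp [LinearMap.lcomp_apply']
  let φ : Module.End R M →ₗ[R] ↥(invLimitSubmodule Z δ) :=
    LinearMap.codRestrict _
      (LinearMap.pi fun n => (E n).toLinearMap ∘ₗ LinearMap.lcomp R M (Z n).subtype)
      fun f n => hδE n (f ∘ₗ (Z (n + 1)).subtype)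
  have hφ : ∀ (f : Module.End R M) (n : ℕ),
      (↑(φ f) : ∀ k, ↥(Z k)) n = E n (f ∘ₗ (Z n).subtype) := fun _ _ => rfl
  refine ⟨LinearEquiv.ofBijective φ ⟨fun f f' h => ?_, fun x => ?_⟩, hφ⟩
  · ext y
    obtain ⟨n, hn⟩ := hsup y
    have hres : f ∘ₗ (Z n).subtype = f' ∘ₗ (Z n).subtype :=
      (E n).injective (by rw [← hφ, ← hφ, h])
    exact LinearMap.congr_fun hres ⟨y, hn⟩
  · obtain ⟨f, hf⟩ := exists_linearMap_comp_subtype_eq Z hmono hsup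
      (fun n => (E n).symm (x.1 n)) fun n => by
        rw [LinearEquiv.eq_symm_apply, ← hδE, LinearEquiv.apply_symm_apply]
        exact x.2 n
    refine ⟨f, Subtype.ext (funext fun n => ?_)⟩
    rw [hφ, hf, LinearEquiv.apply_symm_apply]
end

section
/- Let p be a prime. The additive group of the ring ℤ_p of p-adic integers is self-small as a ℤ-module: for every set I, every additive group homomorphism ℤ_p → ⊕_{i∈I} ℤ_p has image contained in the subsum indexed by a finite subset of I. -/
/-- Every additive endomorphism of `ℤ_[p]` is multiplication by its value at `1`. -/
theorem PadicInt.addMonoidHom_apply_eq_mul {p : ℕ} [Fact p.Prime] (g : ℤ_[p] →+ ℤ_[p])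
    (x : ℤ_[p]) : g x = x * g 1 := by
  have hdvd (n : ℕ) : (p : ℤ_[p]) ^ n ∣ g x - x * g 1 := by
    obtain ⟨y, hy⟩ := Ideal.mem_span_singleton.mp (PadicInt.appr_spec n x)
    have hx : x = x.appr n • (1 : ℤ_[p]) + p ^ n • y := by
      simp only [nsmul_eq_mul, mul_one, Nat.cast_pow]
      linear_combination hy
    have hg : g x = x.appr n * g 1 + p ^ n * g y := by
      conv_lhs => rw [hx, map_add, map_nsmul, map_nsmul]
      simp [nsmul_eq_mul]
    exact ⟨g y - y * g 1, by linear_combination hg - g 1 * hy⟩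
  by_contra h
  obtain ⟨n, hn⟩ := PadicInt.exists_pow_neg_lt p (norm_pos_iff.mpr (sub_ne_zero.mpr h))
  exact hn.not_ge ((PadicInt.norm_le_pow_iff_mem_span_pow _ n).mpr
    (Ideal.mem_span_singleton.mpr (hdvd n)))

/-- **Example (p-adic integers).** Let `p` be a prime. The additive group of the ring
`ℤ_[p]` of `p`-adic integers is self-small as a `ℤ`-module: for every set `ι`, every
additive group homomorphism from `ℤ_[p]` to the direct sum `⊕_{i ∈ ι} ℤ_[p]` (realized
as finitely supported functions `ι →₀ ℤ_[p]`) has image contained in the subsum indexed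
by some finite subset of `ι`. -/
theorem padicInt_self_small (p : ℕ) [Fact p.Prime] (ι : Type*)
    (f : ℤ_[p] →+ (ι →₀ ℤ_[p])) :
    ∃ s : Finset ι, ∀ (x : ℤ_[p]) (i : ι), i ∉ s → f x i = 0 := by
  refine ⟨(f 1).support, fun x i hi => ?_⟩
  have h := PadicInt.addMonoidHom_apply_eq_mul ((Finsupp.applyAddHom i).comp f) x
  simpa [Finsupp.notMem_support_iff.mp hi] using h
end

section
/- Let R be a Dedekind domain and 𝔪 a nonzero maximal ideal of R. Then the 𝔪-adic completion J = lim← R/𝔪^i (the inverse limit of the quotient rings R/𝔪^i along the canonical projections) is self-small as an R-module: for every set I, every R-linear map J → ⊕_{i∈I} J has image contained in the subsum indexed by a finite subset of I. -/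
/-- A linear map from the adic completion of `M` at a finitely generated ideal `I` to an
`I`-adically Hausdorff module that vanishes on the image of `M` is zero. -/
theorem AdicCompletion.linearMap_eq_zero_of_comp_of {R : Type*} [CommRing R] {I : Ideal R}
    (hI : I.FG) {M N : Type*} [AddCommGroup M] [Module R M] [AddCommGroup N] [Module R N]
    [IsHausdorff I N] (g : AdicCompletion I M →ₗ[R] N)
    (hg : ∀ m : M, g (AdicCompletion.of I M m) = 0) : g = 0 := by
  refine LinearMap.ext fun x ↦ ?_
  refine IsHausdorff.haus (I := I) inferInstance _ fun n ↦ SModEq.zero.2 ?_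
  obtain ⟨m, hm⟩ := Submodule.Quotient.mk_surjective _ (AdicCompletion.eval I M n x)
  have hx : x - AdicCompletion.of I M m ∈ I ^ n • (⊤ : Submodule R (AdicCompletion I M)) := by
    rw [AdicCompletion.pow_smul_top_eq_ker_eval hI, LinearMap.mem_ker, map_sub, sub_eq_zero,
      AdicCompletion.eval_of]
    exact hm.symm
  have h := Submodule.mem_map_of_mem (f := g) hx
  rw [map_sub, hg, sub_zero, Submodule.map_smul''] at h
  exact Submodule.smul_mono le_rfl le_top h

/-- **Example (Dedekind domains).** Let `R` be a Dedekind domain and `𝔪` a nonzero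
maximal ideal of `R`. Then the `𝔪`-adic completion `J = lim← R/𝔪^i` (realized as the
`R`-module `AdicCompletion 𝔪 R` of compatible sequences in `∏ i, R/𝔪^i`) is self-small
as an `R`-module: for every set `ι`, every `R`-linear map from `J` to the direct sum
`⊕_{i ∈ ι} J` (realized as finitely supported functions `ι →₀ J`) has image contained in
the subsum indexed by some finite subset of `ι`. -/
theorem adicCompletion_self_small {R : Type*} [CommRing R] [IsDedekindDomain R]
    (𝔪 : Ideal R) (hmax : 𝔪.IsMaximal) (hne : 𝔪 ≠ ⊥)
    (ι : Type*) (f : AdicCompletion 𝔪 R →ₗ[R] (ι →₀ AdicCompletion 𝔪 R)) :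
    ∃ s : Finset ι, ∀ (x : AdicCompletion 𝔪 R) (i : ι), i ∉ s → f x i = 0 := by
  refine ⟨(f (AdicCompletion.of 𝔪 R 1)).support, fun x i hi ↦ ?_⟩
  refine LinearMap.congr_fun (AdicCompletion.linearMap_eq_zero_of_comp_of
    (IsNoetherian.noetherian 𝔪) (Finsupp.lapply i ∘ₗ f) fun r ↦ ?_) x
  rw [← mul_one r, ← smul_eq_mul, map_smul, map_smul, LinearMap.comp_apply,
    Finsupp.lapply_apply, Finsupp.notMem_support_iff.1 hi, smul_zero]
end

section
/- Let R be a Dedekind domain and 𝔪 a nonzero maximal ideal of R, and let J = lim← R/𝔪^i be the 𝔪-adic completion with its natural ring structure and canonical ring homomorphism φ : R → J. Then φ is a weak epimorphism of rings: every R-linear endomorphism of J is J-linear, i.e., every R-linear map f : J → J satisfies f(x) = x · f(1) for all x ∈ J. -/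
/-- If `I` is finitely generated, every `R`-linear endomorphism of the `I`-adic completion of `R`
is multiplication by its value at `1`. -/
theorem AdicCompletion.linearMap_apply_eq_mul_apply_one {R : Type*} [CommRing R] {I : Ideal R}
    (hI : I.FG) (f : AdicCompletion I R →ₗ[R] AdicCompletion I R) (x : AdicCompletion I R) :
    f x = x * f 1 := by
  have map_ker (n : ℕ) (y : AdicCompletion I R) (hy : evalₐ I n y = 0) :
      evalₐ I n (f y) = 0 := by
    have h : I ^ n • ⊤ ≤ I ^ n := (Ideal.mul_top _).le
    have h' : I ^ n ≤ I ^ n • ⊤ := (Ideal.mul_top _).ge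
    have hy' : y ∈ (I ^ n • ⊤ : Submodule R (AdicCompletion I R)) := by
      rw [pow_smul_top_eq_ker_eval hI, LinearMap.mem_ker, ← factor_evalₐ_eq_eval I y h', hy,
        _root_.map_zero]
    have hfy : f y ∈ (I ^ n • ⊤ : Submodule R (AdicCompletion I R)) :=
      Submodule.smul_top_le_comap_smul_top (I ^ n) f hy'
    rw [pow_smul_top_eq_ker_eval hI, LinearMap.mem_ker] at hfy
    rw [← factor_eval_eq_evalₐ I (f y) h, hfy, _root_.map_zero]
  refine ext_evalₐ fun n ↦ ?_
  obtain ⟨r, hr⟩ := Ideal.Quotient.mk_surjective (evalₐ I n x)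
  have hx : evalₐ I n (x - r • 1) = 0 := by
    rw [map_sub, map_smul, map_one, ← hr, sub_eq_zero, Algebra.smul_def, mul_one]
    rfl
  have hfx := map_ker n _ hx
  rw [map_sub, map_smul, map_sub, map_smul, sub_eq_zero] at hfx
  rw [map_sub, map_smul, map_one, sub_eq_zero] at hx
  rw [hfx, map_mul, hx, smul_mul_assoc, one_mul]

/-- **Example (Dedekind domains), weak epimorphism form.** Let `R` be a Dedekind domain
and `𝔪` a nonzero maximal ideal of `R`, and let `J = lim← R/𝔪^i` be the `𝔪`-adic
completion (realized as the `R`-algebra `AdicCompletion 𝔪 R` of compatible sequences in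
`∏ i, R/𝔪^i`), with canonical ring homomorphism `φ : R → J`. Then `φ` is a weak
epimorphism of rings: every `R`-linear endomorphism `f` of `J` is `J`-linear, i.e.
`f x = x * f 1` for all `x : J`. -/
theorem adicCompletion_weak_epimorphism {R : Type*} [CommRing R] [IsDedekindDomain R]
    (𝔪 : Ideal R) (hmax : 𝔪.IsMaximal) (hne : 𝔪 ≠ ⊥)
    (f : AdicCompletion 𝔪 R →ₗ[R] AdicCompletion 𝔪 R) (x : AdicCompletion 𝔪 R) :
    f x = x * f 1 := by
  exact AdicCompletion.linearMap_apply_eq_mul_apply_one 𝔪.fg_of_isNoetherianRing f x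
end
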